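/- Let t(x) = 1 - 2|x| and let Ψ : Set (ℝ × (ℕ → ℤ)) → Set (ℝ × (ℕ → ℤ)) be the monotone operator Ψ(R) = {(x, p) | |x| ≤ 1 ∧ p 0 ∈ {-1, 1} ∧ (x ≠ 0 → ((p 0 = 1 ∧ x ≥ 0) ∨ (p 0 = -1 ∧ x ≤ 0))) ∧ (t x, fun n => p (n+1)) ∈ R}. Then the greatest fixed point of Ψ equals the set {(x, p) | |x| ≤ 1 ∧ (∀ i, p i ∈ {-1, 1}) ∧ ∀ i, t^[i](x) ≠ 0 → ((p i = 1 ∧ t^[i](x) ≥ 0) ∨ (p i = -1 ∧ t^[i](x) ≤ 0))}. (This is the paper's claim that realizers of the coinductive predicate G(x) are exactly the infinite Gray codes of x, i.e. streams with dᵢ = sgb(t^i(x)).) -/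

import Mathlib

noncomputable def tent (x : ℝ) : ℝ := 1 - 2 * |x|

def PsiG : Set (ℝ × (ℕ → ℤ)) →o Set (ℝ × (ℕ → ℤ)) :=
  ⟨fun R => {q | |q.1| ≤ 1 ∧ q.2 0 ∈ ({-1, 1} : Set ℤ) ∧
      (q.1 ≠ 0 → ((q.2 0 = 1 ∧ q.1 ≥ 0) ∨ (q.2 0 = -1 ∧ q.1 ≤ 0))) ∧
      (tent q.1, fun n => q.2 (n + 1)) ∈ R},
   fun R S h q hq => ⟨hq.1, hq.2.1, hq.2.2.1, h hq.2.2.2⟩⟩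

theorem abs_tent_le_one {x : ℝ} (hx : |x| ≤ 1) : |tent x| ≤ 1 := by
  have h := abs_nonneg x
  rw [tent, abs_le]
  constructor <;> linarith

theorem iterate_tent_mem_gfp_PsiG {q : ℝ × (ℕ → ℤ)} (hq : q ∈ OrderHom.gfp PsiG) (i : ℕ) :
    (tent^[i] q.1, fun n => q.2 (n + i)) ∈ OrderHom.gfp PsiG := by
  induction i with
  | zero => exact hq
  | succ i ih =>
    rw [← OrderHom.map_gfp] at ih
    simpa only [Function.iterate_succ_apply', Nat.add_right_comm _ 1 i, ← Nat.add_assoc] using ih.2.2.2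

theorem gfp_PsiG_eq_gray_codes :
    OrderHom.gfp PsiG =
      {q : ℝ × (ℕ → ℤ) | |q.1| ≤ 1 ∧ (∀ i, q.2 i ∈ ({-1, 1} : Set ℤ)) ∧
        ∀ i, tent^[i] q.1 ≠ 0 →
          ((q.2 i = 1 ∧ tent^[i] q.1 ≥ 0) ∨ (q.2 i = -1 ∧ tent^[i] q.1 ≤ 0))} := by
  apply le_antisymm
  · intro q hq
    have step (i : ℕ) : (tent^[i] q.1, fun n => q.2 (n + i)) ∈ PsiG (OrderHom.gfp PsiG) := by
      rw [OrderHom.map_gfp]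
      exact iterate_tent_mem_gfp_PsiG hq i
    refine ⟨(step 0).1, fun i => ?_, fun i => ?_⟩
    · simpa using (step i).2.1
    · simpa using (step i).2.2.1
  · apply OrderHom.le_gfp
    rintro q ⟨hx, hd, hs⟩
    exact ⟨hx, hd 0, hs 0, abs_tent_le_one hx, fun i => hd (i + 1), fun i => hs (i + 1)⟩
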